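/- Let K be a field of characteristic zero and g = (g_1, ..., g_n) ∈ K[x_1, ..., x_n]^n. Let 𝓡_g : K[x_1^{(∞)}, ..., x_n^{(∞)}] → K[x_1, ..., x_n] be the K-algebra homomorphism determined by 𝓡_g(x_i^{(j)}) = 𝓛_g^j(x_i). Then the kernel of 𝓡_g equals the differential ideal I_g = ⟨x_1' − g_1, ..., x_n' − g_n⟩^(∞). -/

import Mathlib

open MvPolynomial

noncomputable section

/-- The canonical derivation on the ring of differential polynomials
`K[x_i^{(j)} : 1 ≤ i ≤ n, j ≥ 0]`, sending `x_i^{(j)}` to `x_i^{(j+1)}`. -/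
def diffDer (K : Type*) [CommRing K] (n : ℕ) :
    Derivation K (MvPolynomial (Fin n × ℕ) K) (MvPolynomial (Fin n × ℕ) K) :=
  MvPolynomial.mkDerivation K fun v => X (v.1, v.2 + 1)

/-- The differential ideal generated by a set `S`: the ideal generated by all
derivatives of elements of `S`. -/
def diffIdeal (K : Type*) [CommRing K] (n : ℕ) (S : Set (MvPolynomial (Fin n × ℕ) K)) :
    Ideal (MvPolynomial (Fin n × ℕ) K) :=
  Ideal.span {q | ∃ f ∈ S, ∃ j : ℕ, q = (⇑(diffDer K n))^[j] f}

/-- The differential ideal `I_g = ⟨x_1' - g_1, …, x_n' - g_n⟩^(∞)` of the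
system `x' = g(x)`. -/
def sysIdeal (K : Type*) [CommRing K] (n : ℕ) (g : Fin n → MvPolynomial (Fin n) K) :
    Ideal (MvPolynomial (Fin n × ℕ) K) :=
  diffIdeal K n (Set.range fun i => X (i, 1) - rename (fun j => (j, 0)) (g i))

/-- The order of a differential polynomial: the largest `j` such that some variable
`x_i^{(j)}` appears. -/
def ordOf {K : Type*} [CommSemiring K] {n : ℕ} (f : MvPolynomial (Fin n × ℕ) K) : ℕ :=
  f.vars.sup Prod.snd

/-- `f` is a minimal polynomial of the elimination ideal `I ∩ K[x_1^{(∞)}]`: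
a nonzero element of `I` involving only the variables `x_1^{(j)}`, of minimal order and
then minimal total degree among all such elements. -/
def IsMinPoly (K : Type*) [Field K] (n : ℕ) [NeZero n]
    (I : Ideal (MvPolynomial (Fin n × ℕ) K)) (f : MvPolynomial (Fin n × ℕ) K) : Prop :=
  f ≠ 0 ∧ f ∈ I ∧ (∀ v ∈ f.vars, v.1 = (0 : Fin n)) ∧
    ∀ h : MvPolynomial (Fin n × ℕ) K, h ≠ 0 → h ∈ I → (∀ v ∈ h.vars, v.1 = (0 : Fin n)) →
      ordOf f ≤ ordOf h ∧ (ordOf h ≤ ordOf f → f.totalDegree ≤ h.totalDegree)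

/-- The map `𝓡_g` sending `x_i^{(j)}` to the `j`-th Lie derivative of `x_i`. -/
def lieEval (K : Type*) [CommRing K] (n : ℕ) (g : Fin n → MvPolynomial (Fin n) K) :
    MvPolynomial (Fin n × ℕ) K →ₐ[K] MvPolynomial (Fin n) K :=
  aeval fun v => (⇑(mkDerivation K g))^[v.2] (X v.1)

section

variable {K : Type*} [CommRing K] {n : ℕ}

theorem diffDer_mem_diffIdeal {S : Set (MvPolynomial (Fin n × ℕ) K)}
    {p : MvPolynomial (Fin n × ℕ) K} (hp : p ∈ diffIdeal K n S) :
    diffDer K n p ∈ diffIdeal K n S := by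
  induction hp using Submodule.span_induction with
  | mem x hx =>
    obtain ⟨f, hf, j, rfl⟩ := hx
    exact Ideal.subset_span ⟨f, hf, j + 1, (Function.iterate_succ_apply' _ _ _).symm⟩
  | zero => simp
  | add x y _ _ hx hy => simpa using add_mem hx hy
  | smul a x hx ih =>
    simp only [smul_eq_mul, Derivation.leibniz]
    exact add_mem (Ideal.mul_mem_left _ _ ih) (Ideal.mul_mem_right _ _ hx)

variable (g : Fin n → MvPolynomial (Fin n) K)

theorem lieEval_diffDer (p : MvPolynomial (Fin n × ℕ) K) :
    lieEval K n g (diffDer K n p) = mkDerivation K g (lieEval K n g p) := by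
  induction p using MvPolynomial.induction_on with
  | C a =>
    rw [← algebraMap_eq, Derivation.map_algebraMap, AlgHom.commutes, Derivation.map_algebraMap,
      map_zero]
  | add p q hp hq => simp only [map_add, hp, hq]
  | mul_X p v hp =>
    have hX : lieEval K n g (diffDer K n (X v)) = mkDerivation K g (lieEval K n g (X v)) := by
      simp only [lieEval, diffDer, mkDerivation_X, aeval_X, Function.iterate_succ_apply']
    simp only [Derivation.leibniz, map_add, map_mul, smul_eq_mul, hp, hX]

theorem lieEval_iterate_diffDer (j : ℕ) (p : MvPolynomial (Fin n × ℕ) K) :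
    lieEval K n g ((⇑(diffDer K n))^[j] p) =
      (⇑(mkDerivation K g))^[j] (lieEval K n g p) :=
  Function.Semiconj.iterate_right (lieEval_diffDer g) j p

theorem lieEval_rename (q : MvPolynomial (Fin n) K) :
    lieEval K n g (rename (fun j => (j, 0)) q) = q := by
  simp only [lieEval, aeval_rename]
  exact aeval_X_left_apply q

theorem sysIdeal_le_ker_lieEval : sysIdeal K n g ≤ RingHom.ker (lieEval K n g) := by
  refine Ideal.span_le.2 ?_
  rintro _ ⟨_, ⟨i, rfl⟩, j, rfl⟩
  have h : lieEval K n g (X (i, 1)) = g i := by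
    simp only [lieEval, aeval_X, Function.iterate_one, mkDerivation_X]
  rw [SetLike.mem_coe, RingHom.mem_ker, lieEval_iterate_diffDer, map_sub, lieEval_rename, h,
    sub_self, iterate_map_zero]

theorem diffDer_rename_sub_mem (q : MvPolynomial (Fin n) K) :
    diffDer K n (rename (fun j => (j, 0)) q) - rename (fun j => (j, 0)) (mkDerivation K g q) ∈
      sysIdeal K n g := by
  induction q using MvPolynomial.induction_on with
  | C a => simp
  | add p q hp hq =>
    simp only [map_add, add_sub_add_comm]
    exact add_mem hp hq
  | mul_X p i hp =>
    have hX : X (i, 1) - rename (fun j => (j, 0)) (g i) ∈ sysIdeal K n g :=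
      Ideal.subset_span ⟨_, ⟨i, rfl⟩, 0, rfl⟩
    have hD : diffDer K n (X (i, 0)) = X (i, 1) := by simp [diffDer]
    simp only [map_mul, map_add, rename_X, Derivation.leibniz, smul_eq_mul, mkDerivation_X, hD]
    convert add_mem (Ideal.mul_mem_left _ (rename (fun j => (j, 0)) p) hX)
      (Ideal.mul_mem_left _ (X (i, 0)) hp) using 1
    ring

theorem X_sub_rename_iterate_mem (i : Fin n) (j : ℕ) :
    X (i, j) - rename (fun k => (k, 0)) ((⇑(mkDerivation K g))^[j] (X i)) ∈
      sysIdeal K n g := by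
  induction j with
  | zero => simp
  | succ j ih =>
    have h := add_mem (diffDer_mem_diffIdeal ih)
      (diffDer_rename_sub_mem g ((⇑(mkDerivation K g))^[j] (X i)))
    have hD : diffDer K n (X (i, j)) = X (i, j + 1) := by simp [diffDer]
    rwa [map_sub, hD, sub_add_sub_cancel, ← Function.iterate_succ_apply' (mkDerivation K g)] at h

theorem sub_rename_lieEval_mem (p : MvPolynomial (Fin n × ℕ) K) :
    p - rename (fun j => (j, 0)) (lieEval K n g p) ∈ sysIdeal K n g := by
  have h : Ideal.Quotient.mkₐ K (sysIdeal K n g) =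
      (Ideal.Quotient.mkₐ K (sysIdeal K n g)).comp
        ((rename fun j => (j, 0)).comp (lieEval K n g)) := by
    ext v
    simp only [AlgHom.comp_apply, Ideal.Quotient.mkₐ_eq_mk, lieEval, aeval_X]
    exact Ideal.Quotient.eq.2 (X_sub_rename_iterate_mem g v.1 v.2)
  exact Ideal.Quotient.eq.1 (DFunLike.congr_fun h p)

theorem ker_lieEval : RingHom.ker (lieEval K n g) = sysIdeal K n g := by
  refine le_antisymm (fun p hp => ?_) (sysIdeal_le_ker_lieEval g)
  have h := sub_rename_lieEval_mem g p
  rwa [(RingHom.mem_ker).1 hp, map_zero, sub_zero] at h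

end

theorem statement5 (K : Type*) [Field K] [CharZero K] (n : ℕ)
    (g : Fin n → MvPolynomial (Fin n) K) :
    RingHom.ker
      (MvPolynomial.aeval
        (fun v : Fin n × ℕ =>
          (⇑(MvPolynomial.mkDerivation K g :
              Derivation K (MvPolynomial (Fin n) K) (MvPolynomial (Fin n) K)))^[v.2]
            (X v.1)) :
        MvPolynomial (Fin n × ℕ) K →ₐ[K] MvPolynomial (Fin n) K) = sysIdeal K n g :=
  ker_lieEval g
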